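/- arXiv:2209.06968 — 4 statements merged into one kernel-verified Lean document; each statement's English description precedes it below -/
import Mathlib

section
/- Let a, b, c, d be points in the oriented Euclidean plane with dist a b = 2, dist b c = 2, dist c d = 2, dist a c ≥ 2, dist b d ≥ 2 and dist a d ≥ 2 (centers of four consecutive tangent unit circles with pairwise disjoint interiors along a path of length 3). If the signs of the oriented angles ∡ a b c and ∡ b c d are equal (i.e., the two interior angles of the path lie on the same side), then the sum of the unsigned angles ∠ a b c + ∠ b c d is at least π. -/
open EuclideanGeometry Real

noncomputable instance : Fact (Module.finrank ℝ (EuclideanSpace ℝ (Fin 2)) = 2) :=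
  ⟨finrank_euclideanSpace_fin⟩

noncomputable instance : Module.Oriented ℝ (EuclideanSpace ℝ (Fin 2)) (Fin 2) :=
  ⟨(EuclideanSpace.basisFun (Fin 2) ℝ).toBasis.orientation⟩

theorem aux_trig (α β : ℝ) (h0 : 0 < α) (h1 : 0 < β) (h : α + β < π)
    (hc : 0 ≤ 1 + cos (α + β) - cos α - cos β) : False := by
  obtain ⟨s, hs⟩ : ∃ s, s = (α + β) / 2 := ⟨_, rfl⟩
  obtain ⟨t, ht⟩ : ∃ t, t = (α - β) / 2 := ⟨_, rfl⟩
  have e1 : α = s + t := by rw [hs, ht]; ring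
  have e2 : β = s - t := by rw [hs, ht]; ring
  have e3 : α + β = 2 * s := by rw [hs]; ring
  rw [e3, cos_two_mul, e1, e2, cos_add, cos_sub] at hc
  have hp : 0 < cos s := cos_pos_of_mem_Ioo ⟨by linarith, by linarith⟩
  have hlt : cos s < cos t := by
    rw [← cos_abs t]
    apply cos_lt_cos_of_nonneg_of_le_pi (abs_nonneg _) (by linarith)
    rw [abs_lt]; constructor <;> linarith
  nlinarith [mul_pos hp (sub_pos.2 hlt)]

theorem aux_inner (a b c : EuclideanSpace ℝ (Fin 2))
    (hab : dist a b = 2) (hbc : dist b c = 2) :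
    inner ℝ (a - b) (c - b) = 4 * cos (∠ a b c) := by
  have := InnerProductGeometry.cos_angle_mul_norm_mul_norm (a - b) (c - b)
  rw [← dist_eq_norm, ← dist_eq_norm, dist_comm c b, hab, hbc] at this
  simp only [EuclideanGeometry.angle, vsub_eq_sub]
  linarith

theorem aux_pos (a b c : EuclideanSpace ℝ (Fin 2))
    (hab : dist a b = 2) (hbc : dist b c = 2) (hac : 2 ≤ dist a c) : 0 < ∠ a b c := by
  rcases (angle_nonneg a b c).eq_or_lt with h | h
  · exfalso
    have := EuclideanGeometry.law_cos a b c
    rw [← h, cos_zero, dist_comm c b, hab, hbc] at this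
    nlinarith
  · exact h

/-- If `a`, `b`, `c`, `d` are the centers of four consecutive tangent unit circles with pairwise
disjoint interiors along a path of length 3, and the two interior oriented angles of the path
have the same sign (they lie on the same side of the path), then the two unsigned angles sum
to at least `π`. -/
theorem stmt_1 (a b c d : EuclideanSpace ℝ (Fin 2))
    (hab : dist a b = 2) (hbc : dist b c = 2) (hcd : dist c d = 2)
    (hac : 2 ≤ dist a c) (hbd : 2 ≤ dist b d) (had : 2 ≤ dist a d)
    (hsign : (∡ a b c).sign = (∡ b c d).sign) :
    π ≤ ∠ a b c + ∠ b c d := by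
  have hα := aux_pos a b c hab hbc hac
  have hβ := aux_pos b c d hbc hcd hbd
  have nab : a ≠ b := by rintro rfl; simp at hab
  have nbc : b ≠ c := by rintro rfl; simp at hbc
  have ncd : c ≠ d := by rintro rfl; simp at hcd
  by_contra! hlt
  apply aux_trig _ _ hα hβ hlt
  have i1 := aux_inner a b c hab hbc
  have i2 := aux_inner b c d hbc hcd
  have i3 : inner ℝ (a - b) (d - c) = -4 * cos (∠ a b c + ∠ b c d) := by
    have key : (o).oangle (a - b) (d - c) = ∡ a b c + ∡ b c d + (π : Real.Angle) := by
      have h1 := (o).oangle_add (sub_ne_zero.2 nab) (sub_ne_zero.2 nbc.symm)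
        (sub_ne_zero.2 ncd.symm)
      have h2 := (o).oangle_neg_left (sub_ne_zero.2 nbc) (sub_ne_zero.2 ncd.symm)
      rw [neg_sub] at h2
      rw [← h1, h2, EuclideanGeometry.oangle, EuclideanGeometry.oangle]
      simp only [vsub_eq_sub, add_assoc]
    have hi := (o).inner_eq_norm_mul_norm_mul_cos_oangle (a - b) (d - c)
    rw [key, Real.Angle.cos_add_pi, ← dist_eq_norm, ← dist_eq_norm, dist_comm d c, hab, hcd] at hi
    have hcos : (∡ a b c + ∡ b c d).cos = cos (∠ a b c + ∠ b c d) := by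
      rcases hs : (∡ a b c).sign with _ | _ | _
      · exfalso
        have h1 := (oangle_sign_eq_zero_iff_collinear (p₁ := a) (p₂ := b) (p₃ := c)).1 hs
        rcases collinear_iff_eq_or_eq_or_angle_eq_zero_or_angle_eq_pi.1 h1 with h | h | h | h
        · exact nab h
        · exact nbc h.symm
        · linarith
        · linarith
      · rw [oangle_eq_neg_angle_of_sign_eq_neg_one hs,
          oangle_eq_neg_angle_of_sign_eq_neg_one (hsign.symm.trans hs), ← neg_add,
          Real.Angle.cos_neg, ← Real.Angle.coe_add, Real.Angle.cos_coe]
      · rw [oangle_eq_angle_of_sign_eq_one hs,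
          oangle_eq_angle_of_sign_eq_one (hsign.symm.trans hs),
          ← Real.Angle.coe_add, Real.Angle.cos_coe]
    rw [hcos] at hi
    linarith
  have e : a - d = (a - b) - (c - b) - (d - c) := by abel
  have n1 : inner ℝ (a - b) (a - b) = (4 : ℝ) := by
    rw [real_inner_self_eq_norm_sq, ← dist_eq_norm, hab]; norm_num
  have n2 : inner ℝ (c - b) (c - b) = (4 : ℝ) := by
    rw [real_inner_self_eq_norm_sq, ← dist_eq_norm, dist_comm, hbc]; norm_num
  have n3 : inner ℝ (d - c) (d - c) = (4 : ℝ) := by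
    rw [real_inner_self_eq_norm_sq, ← dist_eq_norm, dist_comm, hcd]; norm_num
  have hsq : (4 : ℝ) ≤ inner ℝ (a - d) (a - d) := by
    rw [real_inner_self_eq_norm_sq, ← dist_eq_norm]; nlinarith
  rw [← neg_sub c b, inner_neg_left] at i2
  rw [e] at hsq
  generalize a - b = x at *
  generalize c - b = y at *
  generalize d - c = z at *
  simp only [inner_sub_left, inner_sub_right] at hsq
  rw [real_inner_comm x y, real_inner_comm x z, real_inner_comm y z] at hsq
  linarith
end

section
/- Let M be an n × n doubly stochastic matrix over ℝ (n ≥ 1) that is irreducible (for every i, j there exists t ≥ 1 with (M ^ t) i j > 0) and has strictly positive diagonal entries (M i i > 0 for all i). Then for every probability row vector π, the distributions π ᵥ* (M ^ t) converge, as t → ∞, to the uniform distribution i ↦ 1/n. -/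
open Matrix

open Filter

lemma aux_contract {n : ℕ} {P : Matrix (Fin n) (Fin n) ℝ} (hP : P ∈ doublyStochastic ℝ (Fin n))
    (c : ℝ) (hc : ∀ i j, c ≤ P i j) (w : Fin n → ℝ) (hw : ∑ i, w i = 0) :
    ∑ j, |(w ᵥ* P) j| ≤ (1 - n * c) * ∑ i, |w i| := by
  have h1 : ∀ j, |(w ᵥ* P) j| ≤ ∑ i, |w i| * (P i j - c) := by
    intro j
    have : (w ᵥ* P) j = ∑ i, w i * (P i j - c) := by
      simp only [mul_sub, Finset.sum_sub_distrib, ← Finset.sum_mul, hw, zero_mul, sub_zero]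
      rfl
    rw [this]
    refine (Finset.abs_sum_le_sum_abs _ _).trans (le_of_eq ?_)
    refine Finset.sum_congr rfl fun i _ => ?_
    rw [abs_mul, abs_of_nonneg (sub_nonneg.2 (hc i j))]
  refine (Finset.sum_le_sum fun j _ => h1 j).trans (le_of_eq ?_)
  rw [Finset.sum_comm, Finset.mul_sum]
  refine Finset.sum_congr rfl fun i _ => ?_
  rw [← Finset.mul_sum, Finset.sum_sub_distrib, sum_row_of_mem_doublyStochastic hP]
  simp [mul_comm]

lemma aux_sum {n : ℕ} {P : Matrix (Fin n) (Fin n) ℝ} (hP : P ∈ doublyStochastic ℝ (Fin n))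
    (w : Fin n → ℝ) : ∑ j, (w ᵥ* P) j = ∑ i, w i := by
  simp only [Matrix.vecMul, dotProduct]
  rw [Finset.sum_comm]
  refine Finset.sum_congr rfl fun i _ => ?_
  rw [← Finset.mul_sum, sum_row_of_mem_doublyStochastic hP, mul_one]

lemma aux_pos_s5 {n : ℕ} {M : Matrix (Fin n) (Fin n) ℝ} (hM : M ∈ doublyStochastic ℝ (Fin n))
    (hdiag : ∀ i : Fin n, 0 < M i i) (i j : Fin n) (t : ℕ) (h : 0 < (M ^ t) i j) (s : ℕ) :
    0 < (M ^ (t + s)) i j := by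
  induction s with
  | zero => exact h
  | succ s ih =>
    rw [← add_assoc, pow_succ, Matrix.mul_apply]
    refine Finset.sum_pos' (fun k _ => mul_nonneg
      (nonneg_of_mem_doublyStochastic (pow_mem hM _)) (nonneg_of_mem_doublyStochastic hM))
      ⟨j, Finset.mem_univ _, mul_pos ih (hdiag j)⟩

/-- For an irreducible aperiodic (positive diagonal) doubly stochastic matrix, the distribution
of the random walk converges from any initial probability vector to the uniform distribution. -/
theorem stmt_5 (n : ℕ) (hn : 1 ≤ n) (M : Matrix (Fin n) (Fin n) ℝ)
    (hM : M ∈ doublyStochastic ℝ (Fin n))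
    (hirr : ∀ i j : Fin n, ∃ t : ℕ, 1 ≤ t ∧ 0 < (M ^ t) i j)
    (hdiag : ∀ i : Fin n, 0 < M i i)
    (π : Fin n → ℝ) (hπ0 : ∀ i, 0 ≤ π i) (hπ1 : ∑ i, π i = 1) :
    Tendsto (fun t : ℕ => π ᵥ* (M ^ t)) atTop (nhds (fun _ : Fin n => (1 : ℝ) / n)) := by
  have hn0 : (0 : ℝ) < n := by exact_mod_cast hn
  have i0 : Fin n := ⟨0, hn⟩
  haveI : Nonempty (Fin n) := ⟨i0⟩
  choose τ hτ1 hτ using hirr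
  obtain ⟨T, hT1, hT⟩ : ∃ T : ℕ, 1 ≤ T ∧ ∀ i j, 0 < (M ^ T) i j := by
    have hle : ∀ i j, τ i j ≤ ∑ p : Fin n × Fin n, τ p.1 p.2 := fun i j =>
      Finset.single_le_sum (f := fun p : Fin n × Fin n => τ p.1 p.2)
        (fun _ _ => Nat.zero_le _) (Finset.mem_univ (i, j))
    refine ⟨∑ p : Fin n × Fin n, τ p.1 p.2, (hτ1 i0 i0).trans (hle i0 i0), fun i j => ?_⟩
    obtain ⟨s, hs⟩ := Nat.exists_eq_add_of_le (hle i j)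
    rw [hs]
    exact aux_pos_s5 hM hdiag i j _ (hτ i j) s
  obtain ⟨c, hc0, hc⟩ : ∃ c : ℝ, 0 < c ∧ ∀ i j, c ≤ (M ^ T) i j := by
    obtain ⟨p, hp⟩ := Finite.exists_min (fun p : Fin n × Fin n => (M ^ T) p.1 p.2)
    exact ⟨_, hT p.1 p.2, fun i j => hp (i, j)⟩
  have hq0 : 0 ≤ 1 - n * c := by
    have h := sum_row_of_mem_doublyStochastic (pow_mem hM T) i0
    have h2 : ∑ _j : Fin n, c ≤ ∑ j, (M ^ T) i0 j := Finset.sum_le_sum fun j _ => hc i0 j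
    rw [h] at h2
    simp at h2
    linarith
  have hq1 : 1 - n * c < 1 := by nlinarith
  set u : Fin n → ℝ := fun _ => (1 : ℝ) / n with hu
  set w : Fin n → ℝ := π - u with hw
  have hw0 : ∑ i, w i = 0 := by
    simp [hw, hu, hπ1, hn0.ne']
  have hsum : ∀ t, ∑ i, (w ᵥ* M ^ t) i = 0 := fun t => (aux_sum (pow_mem hM t) w).trans hw0
  let f : ℕ → ℝ := fun t => ∑ j, |(w ᵥ* M ^ t) j|
  have hf0 : ∀ t, 0 ≤ f t := fun t => Finset.sum_nonneg fun _ _ => abs_nonneg _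
  have hmono : ∀ t s, f (t + s) ≤ f t := by
    intro t s
    have := aux_contract (pow_mem hM s) 0
      (fun i j => nonneg_of_mem_doublyStochastic (pow_mem hM s)) _ (hsum t)
    rw [Matrix.vecMul_vecMul, ← pow_add] at this
    simpa [f] using this
  have hstep : ∀ t, f (t + T) ≤ (1 - n * c) * f t := by
    intro t
    have := aux_contract (pow_mem hM T) c hc _ (hsum t)
    rwa [Matrix.vecMul_vecMul, ← pow_add] at this
  have hk : ∀ k, f (T * k) ≤ (1 - n * c) ^ k * f 0 := by
    intro k
    induction k with
    | zero => simp
    | succ k ih =>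
      rw [mul_add, mul_one, pow_succ']
      refine (hstep _).trans ?_
      rw [mul_assoc]
      exact mul_le_mul_of_nonneg_left ih hq0
  have hlim : Tendsto f atTop (nhds 0) := by
    have h1 : Tendsto (fun t : ℕ => (1 - n * c) ^ (t / T) * f 0) atTop (nhds 0) := by
      have h2 := (tendsto_pow_atTop_nhds_zero_of_lt_one hq0 hq1).comp
        (Nat.tendsto_div_const_atTop (n := T) (by omega))
      simpa using h2.mul_const (f 0)
    refine squeeze_zero hf0 (fun t => ?_) h1
    refine le_trans ?_ (hk (t / T))
    have := hmono (T * (t / T)) (t % T)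
    rwa [Nat.div_add_mod] at this
  have huM : ∀ t, u ᵥ* M ^ t = u := by
    intro t
    have h := one_vecMul_of_mem_doublyStochastic (pow_mem hM t)
    have hu1 : u = ((1 : ℝ) / n) • (1 : Fin n → ℝ) := by ext; simp [hu]
    rw [hu1, Matrix.smul_vecMul, h]
  rw [tendsto_pi_nhds]
  intro j
  rw [tendsto_iff_dist_tendsto_zero]
  refine squeeze_zero (fun _ => dist_nonneg) (fun t => ?_) hlim
  have : (π ᵥ* M ^ t) j - u j = (w ᵥ* M ^ t) j := by
    rw [hw, Matrix.sub_vecMul, huM, Pi.sub_apply]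
  rw [Real.dist_eq, this]
  exact Finset.single_le_sum (f := fun j => |(w ᵥ* M ^ t) j|)
    (fun _ _ => abs_nonneg _) (Finset.mem_univ j)
end

section
/- Let n, k ≥ 1 be natural numbers and set p = 1 − (1 − 1/n)^k (the probability that at a synchronized time at least one of k independently uniformly placed robots is at a given point, in a system of n trajectories). Then p > 0 and 1 / p ≤ n / k + 1 (as real numbers). -/
/-- With `p = 1 - (1 - 1/n)^k` the probability that some robot is at a given point, `p` is
positive and the mean `1/p` of the corresponding geometric waiting time is at most `n/k + 1`. -/
theorem stmt_8 (n k : ℕ) (hn : 1 ≤ n) (hk : 1 ≤ k) (p : ℝ)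
    (hp : p = 1 - (1 - 1 / (n : ℝ)) ^ k) :
    0 < p ∧ 1 / p ≤ (n : ℝ) / (k : ℝ) + 1 := by
  have hn' : (1 : ℝ) ≤ n := by exact_mod_cast hn
  have hk' : (1 : ℝ) ≤ k := by exact_mod_cast hk
  have hn0 : (0 : ℝ) < n := by linarith
  have hk0 : (0 : ℝ) < k := by linarith
  have hx0 : 0 < 1 / (n : ℝ) := by positivity
  have hx1 : 1 / (n : ℝ) ≤ 1 := by
    rw [div_le_one hn0]
    exact hn'
  have hq0 : 0 ≤ (1 - 1 / (n : ℝ)) ^ k := pow_nonneg (by linarith) k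
  have hB : 1 + (k : ℝ) * (1 / (n : ℝ)) ≤ (1 + 1 / (n : ℝ)) ^ k :=
    one_add_mul_le_pow (by linarith) k
  have hprod : (1 - 1 / (n : ℝ)) ^ k * (1 + 1 / (n : ℝ)) ^ k ≤ 1 := by
    rw [← mul_pow]
    apply pow_le_one₀
    · exact mul_nonneg (by linarith) (by linarith)
    · nlinarith
  have hmain : (1 - 1 / (n : ℝ)) ^ k * (1 + (k : ℝ) * (1 / (n : ℝ))) ≤ 1 :=
    (mul_le_mul_of_nonneg_left hB hq0).trans hprod
  have hqp : (1 - 1 / (n : ℝ)) ^ k = 1 - p := by linarith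
  rw [hqp] at hmain
  have h2 : (1 - p) * (n + k) ≤ n := by
    have h := mul_le_mul_of_nonneg_right hmain hn0.le
    have e : (1 - p) * (1 + (k : ℝ) * (1 / (n : ℝ))) * n = (1 - p) * (n + k) := by
      field_simp
    linarith
  have hpk : (k : ℝ) ≤ p * (n + k) := by linarith
  have hp0 : 0 < p := by
    by_contra hneg
    have : p * ((n : ℝ) + k) ≤ 0 :=
      mul_nonpos_of_nonpos_of_nonneg (not_lt.mp hneg) (by linarith)
    linarith
  refine ⟨hp0, ?_⟩
  have e : (n : ℝ) / k + 1 = (n + k) / k := by field_simp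
  rw [e, div_le_div_iff₀ hp0 hk0]
  linarith
end

section
/- Let n, k ≥ 1 be natural numbers and set p = 1 − (1 − 1/n)^k (as a real number). Then the mean of the geometric distribution with success probability p satisfies ∑' (t : ℕ), (t + 1) * (p * (1 − p)^t) ≤ n / k + 1. In particular, in a randomized synchronized system of n trajectories patrolled by k robots whose positions at synchronized times are independent and uniform, the expected time between two consecutive visits to any fixed point is at most n/k + 1. -/
/-- The mean of a geometric waiting time (supported on `{1, 2, 3, …}`) with success probability
`p = 1 - (1 - 1/n)^k` is at most `n/k + 1`: the expected time between two consecutive visits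
to any fixed point by `k` robots on `n` trajectories is at most `n/k + 1`. -/
theorem stmt_10 (n k : ℕ) (hn : 1 ≤ n) (hk : 1 ≤ k) (p : ℝ)
    (hp : p = 1 - (1 - 1 / (n : ℝ)) ^ k) :
    ∑' t : ℕ, ((t : ℝ) + 1) * (p * (1 - p) ^ t) ≤ (n : ℝ) / (k : ℝ) + 1 := by
  have hn' : (1 : ℝ) ≤ n := by exact_mod_cast hn
  have hk' : (1 : ℝ) ≤ k := by exact_mod_cast hk
  obtain ⟨x, hx⟩ : ∃ x : ℝ, x = 1 / (n : ℝ) := ⟨_, rfl⟩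
  have hx0 : 0 < x := by rw [hx]; positivity
  have hx1 : x ≤ 1 := by rw [hx, div_le_one (by linarith)]; exact hn'
  have hnx : (n : ℝ) * x = 1 := by rw [hx]; field_simp
  rw [← hx] at hp
  obtain ⟨q, hq⟩ : ∃ q : ℝ, q = (1 - x) ^ k := ⟨_, rfl⟩
  rw [← hq] at hp
  have hq0 : 0 ≤ q := by rw [hq]; exact pow_nonneg (by linarith) k
  have hB : 1 + (k : ℝ) * x ≤ (1 + x) ^ k := one_add_mul_le_pow (by linarith) k
  have hmain : q * (1 + k * x) ≤ 1 := by
    calc q * (1 + k * x) ≤ q * (1 + x) ^ k := mul_le_mul_of_nonneg_left hB hq0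
      _ = ((1 - x) * (1 + x)) ^ k := by rw [hq, mul_pow]
      _ ≤ 1 := pow_le_one₀ (mul_nonneg (by linarith) (by linarith)) (by nlinarith)
  have hkx : 0 < (k : ℝ) * x := by positivity
  have hq1 : q < 1 := by
    by_contra h
    push Not at h
    nlinarith
  have hp0 : 0 < p := by linarith
  have hpq : 1 - p = q := by linarith
  have hnorm : ‖q‖ < 1 := by rw [Real.norm_eq_abs, abs_of_nonneg hq0]; exact hq1
  have h1 := hasSum_coe_mul_geometric_of_norm_lt_one hnorm
  have h2 := hasSum_geometric_of_norm_lt_one hnorm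
  have h3 := (h1.add h2).mul_left p
  have hs : ∑' t : ℕ, ((t : ℝ) + 1) * (p * (1 - p) ^ t) = 1 / p := by
    have h4 : p * (q / (1 - q) ^ 2 + (1 - q)⁻¹) = 1 / p := by
      rw [show 1 - q = p by linarith]
      field_simp
      linarith
    rw [← h4, ← h3.tsum_eq, hpq]
    congr 1
    funext t
    ring
  rw [hs, div_le_iff₀ hp0]
  have h5 : (k : ℝ) ≤ (n + k) * p := by
    have h6 : (n : ℝ) * (q * (1 + k * x)) ≤ n * 1 :=
      mul_le_mul_of_nonneg_left hmain (by linarith)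
    have h7 : (n : ℝ) * (q * (1 + k * x)) = q * n + q * k * (n * x) := by ring
    rw [h7, hnx] at h6
    rw [hp]
    linarith
  have h8 : ((n : ℝ) / k + 1) * p = ((n + k) * p) / k := by field_simp
  rw [h8, le_div_iff₀ (by linarith)]
  linarith
end
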